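/- Let n ≥ 3 be an integer and let μ ≥ 0, a ≤ 0, b ≥ 0 be real constants. Then there exists a constant C > 0, depending only on n, such that for every R > 0 and every smooth function v on ℝⁿ that is positive on the open ball B(0,R) and satisfies the Einstein-scalar field Lichnerowicz-type equation Δv + μ·v + a·v^{(n+2)/(n−2)} + b·v^{−(3n−2)/(n−2)} = 0 on B(0,R), one has |∇v(x)|²/v(x)² ≤ C/R² for every x in B(0,R/2). (This is the Euclidean case κ = 0 of the gradient estimate in Theorem 3, corresponding to p = 4/(n−2) and q = 4(n−1)/(n−2) in equation (1.1).) -/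

import Mathlib

open Real

/-- The Euclidean Laplace operator: sum of second partial derivatives. -/
noncomputable def lap {n : ℕ} (v : EuclideanSpace ℝ (Fin n) → ℝ)
    (x : EuclideanSpace ℝ (Fin n)) : ℝ :=
  ∑ i, fderiv ℝ (fun y => fderiv ℝ v y (EuclideanSpace.single i 1)) x
    (EuclideanSpace.single i 1)

open scoped ContDiff Topology

/-- Partial derivative in direction `i`. -/
noncomputable def pd {n : ℕ} (i : Fin n) (g : EuclideanSpace ℝ (Fin n) → ℝ)
    (x : EuclideanSpace ℝ (Fin n)) : ℝ := fderiv ℝ g x (EuclideanSpace.single i 1)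

/-- Smoothness at each point of a set. -/
def Sm {n : ℕ} (U : Set (EuclideanSpace ℝ (Fin n))) (g : EuclideanSpace ℝ (Fin n) → ℝ) : Prop :=
  ∀ x ∈ U, ContDiffAt ℝ ∞ g x

section calc1
variable {n : ℕ} {U : Set (EuclideanSpace ℝ (Fin n))} {g h : EuclideanSpace ℝ (Fin n) → ℝ}

lemma Sm.diff (hg : Sm U g) {x} (hx : x ∈ U) : DifferentiableAt ℝ g x :=
  (hg x hx).differentiableAt (by simp)

lemma Sm.pd (hg : Sm U g) (i : Fin n) : Sm U (pd i g) := by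
  intro x hx
  have := (hg x hx).fderiv_right (m := ∞) (by simp)
  exact this.clm_apply contDiffAt_const

lemma pd_mul (hg : Sm U g) (hh : Sm U h) (i : Fin n) {x} (hx : x ∈ U) :
    pd i (fun y => g y * h y) x = pd i g x * h x + g x * pd i h x := by
  unfold _root_.pd
  rw [fderiv_fun_mul (hg.diff hx) (hh.diff hx)]
  simp; ring

lemma pd_add (hg : Sm U g) (hh : Sm U h) (i : Fin n) {x} (hx : x ∈ U) :
    pd i (fun y => g y + h y) x = pd i g x + pd i h x := by
  unfold _root_.pd
  rw [fderiv_fun_add (hg.diff hx) (hh.diff hx)]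
  simp

lemma pd_sum {ι : Type*} (s : Finset ι) {G : ι → EuclideanSpace ℝ (Fin n) → ℝ}
    (hg : ∀ j, Sm U (G j)) (i : Fin n) {x} (hx : x ∈ U) :
    pd i (fun y => ∑ j ∈ s, G j y) x = ∑ j ∈ s, pd i (G j) x := by
  unfold _root_.pd
  rw [fderiv_fun_sum (fun j _ => (hg j).diff hx)]
  simp

lemma pd_comp {φ : ℝ → ℝ} {d : ℝ} (hg : Sm U g) (i : Fin n) {x} (hx : x ∈ U)
    (hφ : HasDerivAt φ d (g x)) :
    pd i (fun y => φ (g y)) x = d * pd i g x := by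
  unfold _root_.pd
  have := hφ.comp_hasFDerivAt x (hg.diff hx).hasFDerivAt
  have h2 := this.fderiv
  simp only [Function.comp_def] at h2
  rw [h2]; simp

lemma pd_congr (hU : IsOpen U) (i : Fin n) (hgh : ∀ y ∈ U, g y = h y) {x} (hx : x ∈ U) :
    pd i g x = pd i h x := by
  unfold _root_.pd
  have : g =ᶠ[𝓝 x] h := Filter.eventuallyEq_of_mem (hU.mem_nhds hx) hgh
  rw [this.fderiv_eq]

lemma pd_comm (hg : Sm U g) (i j : Fin n) {x} (hx : x ∈ U) :
    pd i (pd j g) x = pd j (pd i g) x := by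
  have hs : IsSymmSndFDerivAt ℝ g x :=
    (hg x hx).isSymmSndFDerivAt (by
      simp only [minSmoothness_of_isRCLikeNormedField]
      exact WithTop.coe_le_coe.2 (le_top : (2 : ℕ∞) ≤ ⊤))
  have hd : DifferentiableAt ℝ (fderiv ℝ g) x :=
    ((hg x hx).fderiv_right (m := ∞) (by simp)).differentiableAt (by simp)
  have key : ∀ k l : Fin n, _root_.pd k (_root_.pd l g) x =
      fderiv ℝ (fderiv ℝ g) x (EuclideanSpace.single k 1) (EuclideanSpace.single l 1) := by
    intro k l
    unfold _root_.pd
    rw [fderiv_clm_apply hd (differentiableAt_const _)]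
    simp
  rw [key, key]
  exact hs _ _

lemma Sm.mul (hg : Sm U g) (hh : Sm U h) : Sm U (fun y => g y * h y) :=
  fun x hx => (hg x hx).mul (hh x hx)

lemma Sm.add (hg : Sm U g) (hh : Sm U h) : Sm U (fun y => g y + h y) :=
  fun x hx => (hg x hx).add (hh x hx)

lemma Sm.const (c : ℝ) : Sm U (fun _ => c) := fun _ _ => contDiffAt_const

lemma pd_const (c : ℝ) (i : Fin n) (x) : pd i (fun _ => c) x = 0 := by
  simp [_root_.pd]

lemma Sm.sum {ι : Type*} (s : Finset ι) {G : ι → EuclideanSpace ℝ (Fin n) → ℝ}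
    (hg : ∀ j, Sm U (G j)) : Sm U (fun y => ∑ j ∈ s, G j y) :=
  fun x hx => ContDiffAt.sum (fun j _ => hg j x hx)

lemma Sm.congr (hU : IsOpen U) (hg : Sm U g) (hgh : ∀ y ∈ U, h y = g y) : Sm U h :=
  fun x hx => (hg x hx).congr_of_eventuallyEq
    (Filter.eventuallyEq_of_mem (hU.mem_nhds hx) hgh)

end calc1

/-- Second derivative test (necessary condition) in one variable. -/
lemma second_deriv_nonpos {g : ℝ → ℝ} (hm : IsLocalMax g 0) (hc : ContinuousAt g 0) :
    deriv (deriv g) 0 ≤ 0 := by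
  by_contra hpos
  push Not at hpos
  have hmin := isLocalMin_of_deriv_deriv_pos hpos hm.deriv_eq_zero hc
  have heq : g =ᶠ[𝓝 0] fun _ => g 0 := by
    filter_upwards [hm, hmin] with t h1 h2
    exact le_antisymm h1 h2
  have h1 : deriv g =ᶠ[𝓝 0] fun _ => 0 := by
    have := heq.deriv
    simpa using this
  have h2 := h1.deriv_eq
  simp at h2
  linarith

lemma pd_pd_nonpos {n : ℕ} {U : Set (EuclideanSpace ℝ (Fin n))} (hU : IsOpen U)
    {g : EuclideanSpace ℝ (Fin n) → ℝ} (hg : Sm U g) {x} (hx : x ∈ U) (hm : IsLocalMax g x)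
    (i : Fin n) : pd i g x = 0 ∧ pd i (pd i g) x ≤ 0 := by
  refine ⟨by simp [pd, hm.fderiv_eq_zero], ?_⟩
  set e : EuclideanSpace ℝ (Fin n) := EuclideanSpace.single i 1 with he
  have hl : ∀ t : ℝ, HasDerivAt (fun t : ℝ => x + t • e) e t := by
    intro t
    simpa using ((hasDerivAt_id t).smul_const e).const_add x
  have hl0 : Filter.Tendsto (fun t : ℝ => x + t • e) (𝓝 0) (𝓝 x) := by
    have := (hl 0).continuousAt.tendsto
    simpa using this
  have hder : ∀ k : EuclideanSpace ℝ (Fin n) → ℝ, Sm U k → ∀ t : ℝ, x + t • e ∈ U →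
      HasDerivAt (fun t : ℝ => k (x + t • e)) (pd i k (x + t • e)) t := by
    intro k hk t ht
    exact (hk.diff ht).hasFDerivAt.comp_hasDerivAt t (hl t)
  have hev : ∀ᶠ t : ℝ in 𝓝 0, x + t • e ∈ U := hl0 (hU.mem_nhds hx)
  have h1 : deriv (fun t : ℝ => g (x + t • e)) =ᶠ[𝓝 0] fun t => pd i g (x + t • e) := by
    filter_upwards [hev] with t ht using (hder g hg t ht).deriv
  have hx0 : x + (0:ℝ) • e ∈ U := by simpa using hx
  have h2 : deriv (deriv (fun t : ℝ => g (x + t • e))) 0 = pd i (pd i g) x := by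
    rw [h1.deriv_eq, (hder _ (hg.pd i) 0 hx0).deriv]; simp
  rw [← h2]
  apply second_deriv_nonpos
  · have : ∀ᶠ t : ℝ in 𝓝 0, g (x + t • e) ≤ g x := hl0 hm
    simpa [IsLocalMax, IsMaxFilter] using this
  · exact (hder g hg 0 hx0).continuousAt

/-- Bochner inequality for `w = log v`. -/
lemma bochner {n : ℕ} (hn : 3 ≤ n) {U : Set (EuclideanSpace ℝ (Fin n))} (hU : IsOpen U)
    {w : EuclideanSpace ℝ (Fin n) → ℝ} (hw : Sm U w) {μ a b p q : ℝ} (hμ : 0 ≤ μ) (ha : a ≤ 0)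
    (hb : 0 ≤ b) (hp : 1 / (2 * (n : ℝ)) ≤ p) (hq : 0 ≤ q)
    (heq : ∀ x ∈ U, ∑ i, pd i (pd i w) x =
      -(∑ j, pd j w x * pd j w x) + (-μ + (-a * exp (p * w x) + -b * exp (-q * w x))))
    {x} (hx : x ∈ U) :
    1 / (2 * (n : ℝ)) * (∑ j, pd j w x * pd j w x) ^ 2
      - 2 * ∑ j, pd j w x * pd j (fun y => ∑ k, pd k w y * pd k w y) x
      ≤ ∑ i, pd i (pd i (fun y => ∑ k, pd k w y * pd k w y)) x := by
  set f : EuclideanSpace ℝ (Fin n) → ℝ := fun y => ∑ k, pd k w y * pd k w y with hf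
  have hfS : Sm U f := Sm.sum _ fun k => (hw.pd k).mul (hw.pd k)
  have hE : ∀ c : ℝ, Sm U (fun y => exp (c * w y)) := fun c y hy =>
    (contDiffAt_const.mul (hw y hy)).exp
  have hpE : ∀ c j, pd j (fun y => exp (c * w y)) x = (c * exp (c * w x)) * pd j w x := by
    intro c j
    apply pd_comp (φ := fun s => exp (c * s)) hw j hx
    have := ((hasDerivAt_id (w x)).const_mul c).exp
    simpa [mul_comm] using this
  have h1 : ∀ i, ∀ y ∈ U, pd i f y = ∑ k, 2 * (pd k w y * pd i (pd k w) y) := by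
    intro i y hy
    rw [hf, pd_sum _ (fun k => (hw.pd k).mul (hw.pd k)) i hy]
    refine Finset.sum_congr rfl fun k _ => ?_
    rw [pd_mul (hw.pd k) (hw.pd k) i hy]; ring
  have h2 : ∀ i, pd i (pd i f) x = ∑ k, (2 * (pd i (pd k w) x) ^ 2
      + 2 * (pd k w x * pd k (pd i (pd i w)) x)) := by
    intro i
    rw [pd_congr hU i (h1 i) hx,
      pd_sum _ (fun k => (Sm.const 2).mul ((hw.pd k).mul ((hw.pd k).pd i))) i hx]
    refine Finset.sum_congr rfl fun k _ => ?_
    rw [pd_mul (Sm.const 2) ((hw.pd k).mul ((hw.pd k).pd i)) i hx, pd_const,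
      pd_mul (hw.pd k) ((hw.pd k).pd i) i hx,
      pd_congr hU i (g := pd i (pd k w)) (h := pd k (pd i w)) (fun y hy => pd_comm hw i k hy) hx,
      pd_comm (hw.pd i) i k hx]
    ring
  have h3 : ∀ k, ∑ i, pd k (pd i (pd i w)) x = - pd k f x + (-a * p * exp (p * w x)
      + b * q * exp (-q * w x)) * pd k w x := by
    intro k
    rw [← pd_sum _ (fun i => (hw.pd i).pd i) k hx, pd_congr hU k
      (h := fun y => (-1) * f y + (-μ + (-a * exp (p * w y) + -b * exp (-q * w y))))
      (fun y hy => by rw [heq y hy]; simp [hf]) hx]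
    have s1 := (Sm.const (-a)).mul (hE p)
    have s2 := (Sm.const (-b)).mul (hE (-q))
    rw [pd_add ((Sm.const (-1)).mul hfS) ((Sm.const (-μ)).add (s1.add s2)) k hx,
      pd_add (Sm.const (-μ)) (s1.add s2) k hx, pd_add s1 s2 k hx,
      pd_mul (Sm.const (-1)) hfS k hx, pd_mul (Sm.const (-a)) (hE p) k hx,
      pd_mul (Sm.const (-b)) (hE (-q)) k hx, hpE, hpE]
    simp only [pd_const]
    ring
  have h4 : ∑ i, pd i (pd i f) x = 2 * (∑ i, ∑ k, (pd i (pd k w) x) ^ 2)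
      + (-2 * ∑ k, pd k w x * pd k f x)
      + 2 * (-a * p * exp (p * w x) + b * q * exp (-q * w x)) * f x := by
    have e1 : ∑ i, pd i (pd i f) x = 2 * (∑ i, ∑ k, (pd i (pd k w) x) ^ 2)
        + 2 * ∑ k, pd k w x * ∑ i, pd k (pd i (pd i w)) x := by
      simp only [h2, Finset.sum_add_distrib, Finset.mul_sum]
      congr 1
      exact Finset.sum_comm
    rw [e1]
    simp only [h3, hf, Finset.mul_sum, ← Finset.sum_add_distrib]
    refine Finset.sum_congr rfl fun k _ => ?_
    ring
  have h5 : (∑ i, pd i (pd i w) x) ^ 2 ≤ n * ∑ i, ∑ k, (pd i (pd k w) x) ^ 2 := by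
    have c1 : (∑ i, pd i (pd i w) x) ^ 2 ≤ n * ∑ i, (pd i (pd i w) x) ^ 2 := by
      simpa using sq_sum_le_card_mul_sum_sq (s := Finset.univ) (f := fun i => pd i (pd i w) x)
    refine c1.trans ?_
    gcongr with i
    exact Finset.single_le_sum (f := fun k => (pd i (pd k w) x) ^ 2)
      (fun k _ => sq_nonneg _) (Finset.mem_univ i)
  have hn0 : (0:ℝ) < n := by exact_mod_cast (by omega : 0 < n)
  have hf0 : 0 ≤ f x := Finset.sum_nonneg fun k _ => mul_self_nonneg _
  rw [h4]
  rw [heq x hx] at h5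
  change (-(f x) + _) ^ 2 ≤ _ at h5
  change 1 / (2 * (n:ℝ)) * (f x) ^ 2 - _ ≤ _
  set A := -a * exp (p * w x) with hA
  set B := b * exp (-q * w x) with hB
  have hA0 : 0 ≤ A := mul_nonneg (by linarith) (exp_pos _).le
  have hB0 : 0 ≤ B := mul_nonneg hb (exp_pos _).le
  have r1 : -a * p * exp (p * w x) + b * q * exp (-q * w x) = p * A + q * B := by
    rw [hA, hB]; ring
  rw [r1]
  rw [show -b * exp (-q * w x) = -B by rw [hB]; ring] at h5
  set S := ∑ i, ∑ k, (pd i (pd k w) x) ^ 2 with hS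
  have hS0 : 0 ≤ S := by positivity
  set c := 1 / (2 * (n:ℝ)) with hc
  have hc0 : 0 < c := by positivity
  have hcn : c * n = 1 / 2 := by rw [hc]; field_simp
  have key : c * (f x) ^ 2 ≤ 2 * S + 2 * (p * A + q * B) * f x := by
    have hqBf : 0 ≤ q * B * f x := by positivity
    have hpc : c * A * f x ≤ p * A * f x := by gcongr
    have hcA : 0 ≤ c * A * f x := by positivity
    rcases le_total (f x / 2) A with hcase | hcase
    · have : c * (f x / 2) * f x ≤ c * A * f x := by gcongr
      nlinarith
    · have hG : (f x / 2) ^ 2 ≤ (-(f x) + (-μ + (A + -B))) ^ 2 := by nlinarith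
      have hS2 : c * (f x / 2)^2 ≤ c * (n * S) := by gcongr; exact hG.trans h5
      have : c * (n * S) = S / 2 := by rw [← mul_assoc, hcn]; ring
      nlinarith
  linarith

lemma norm_sq_sum {n : ℕ} (x : EuclideanSpace ℝ (Fin n)) : ‖x‖ ^ 2 = ∑ i, x i * x i := by
  rw [EuclideanSpace.norm_sq_eq]
  simp [pow_two]

lemma pd_cutoff {n : ℕ} (r : ℝ) (i : Fin n) (x : EuclideanSpace ℝ (Fin n)) :
    pd i (fun y => r ^ 2 - ‖y‖ ^ 2) x = -2 * x i := by
  have h := ((hasStrictFDerivAt_norm_sq x).hasFDerivAt.const_sub (r ^ 2)).fderiv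
  unfold pd
  rw [h]
  simp [EuclideanSpace.inner_single_right]

lemma pd_coord {n : ℕ} (i : Fin n) (x : EuclideanSpace ℝ (Fin n)) :
    pd i (fun y => -2 * y i) x = -2 := by
  have h : HasFDerivAt (fun y : EuclideanSpace ℝ (Fin n) => -2 * y i)
      ((-2 : ℝ) • (EuclideanSpace.proj i : EuclideanSpace ℝ (Fin n) →L[ℝ] ℝ)) x :=
    ((EuclideanSpace.proj i : EuclideanSpace ℝ (Fin n) →L[ℝ] ℝ).hasFDerivAt (x := x)).const_mul _
  unfold pd
  rw [h.fderiv]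
  simp

/-- Maximum principle step. -/
lemma maxstep {n : ℕ} (hn : 3 ≤ n) {R r : ℝ} (hr : 0 < r) (hrR : r < R)
    {w : EuclideanSpace ℝ (Fin n) → ℝ} (hw : Sm (Metric.ball 0 R) w)
    (hB : ∀ x ∈ Metric.ball (0 : EuclideanSpace ℝ (Fin n)) R,
      1 / (2 * (n : ℝ)) * (∑ j, pd j w x * pd j w x) ^ 2
      - 2 * ∑ j, pd j w x * pd j (fun y => ∑ k, pd k w y * pd k w y) x
      ≤ ∑ i, pd i (pd i (fun y => ∑ k, pd k w y * pd k w y)) x)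
    {x : EuclideanSpace ℝ (Fin n)} (hx : ‖x‖ ≤ r) :
    (r ^ 2 - ‖x‖ ^ 2) ^ 2 * (∑ j, pd j w x * pd j w x) ≤ 4 * n * (24 + 68 * n) * r ^ 2 := by
  set U := Metric.ball (0 : EuclideanSpace ℝ (Fin n)) R with hUdef
  have hU : IsOpen U := Metric.isOpen_ball
  set f : EuclideanSpace ℝ (Fin n) → ℝ := fun y => ∑ k, pd k w y * pd k w y with hf
  have hfS : Sm U f := Sm.sum _ fun k => (hw.pd k).mul (hw.pd k)
  set φ : EuclideanSpace ℝ (Fin n) → ℝ := fun y => r ^ 2 - ‖y‖ ^ 2 with hφ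
  have hφS : Sm U φ := fun y _ => contDiffAt_const.sub (contDiff_norm_sq ℝ).contDiffAt
  have hF : Sm U (fun y => (φ y * φ y) * f y) := (hφS.mul hφS).mul hfS
  have hsub : Metric.closedBall (0 : EuclideanSpace ℝ (Fin n)) r ⊆ U :=
    Metric.closedBall_subset_ball hrR
  have hn0 : (0:ℝ) < n := by exact_mod_cast (by omega : 0 < n)
  obtain ⟨z, hz, hzmax⟩ := (isCompact_closedBall (0 : EuclideanSpace ℝ (Fin n)) r).exists_isMaxOn
    ⟨x, by simpa using hx⟩ (f := fun y => (φ y * φ y) * f y)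
    (fun y hy => (hF y (hsub hy)).continuousAt.continuousWithinAt)
  have hzU := hsub hz
  have hxz : (φ x * φ x) * f x ≤ (φ z * φ z) * f z := hzmax (by simpa using hx)
  suffices hmain : (φ z * φ z) * f z ≤ 4 * n * (24 + 68 * n) * r ^ 2 by
    calc _ = (φ x * φ x) * f x := by simp only [hφ, hf]; ring
      _ ≤ _ := hxz.trans hmain
  have hRHS : 0 ≤ 4 * n * (24 + 68 * n) * r ^ 2 := by positivity
  rcases le_or_gt ((φ z * φ z) * f z) 0 with hle | hpos
  · exact hle.trans hRHS
  have hzr : ‖z‖ ≤ r := by simpa using hz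
  have hφz0 : 0 ≤ φ z := by
    simp only [hφ]; nlinarith [norm_nonneg z]
  have hφz : 0 < φ z := by
    rcases hφz0.eq_or_lt with h | h
    · rw [← h] at hpos; simp at hpos
    · exact h
  have hfz : 0 < f z := by
    by_contra hcon
    push Not at hcon
    nlinarith [mul_pos hφz hφz]
  have hzlt : ‖z‖ < r := by
    have : ‖z‖ ^ 2 < r ^ 2 := by simp only [hφ] at hφz; linarith
    nlinarith [norm_nonneg z]
  have hloc : IsLocalMax (fun y => (φ y * φ y) * f y) z :=
    hzmax.isLocalMax (Filter.mem_of_superset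
      (Metric.isOpen_ball.mem_nhds (by simpa using hzlt)) Metric.ball_subset_closedBall)
  have hφ1 : ∀ i, ∀ y ∈ U, pd i φ y = -2 * y i := fun i y _ => pd_cutoff r i y
  have hφ2 : ∀ i, pd i (pd i φ) z = -2 := fun i => by
    rw [pd_congr hU i (hφ1 i) hzU, pd_coord]
  have hF1 : ∀ i, ∀ y ∈ U, pd i (fun y => (φ y * φ y) * f y) y
      = (2 * (φ y * pd i φ y)) * f y + (φ y * φ y) * pd i f y := by
    intro i y hy
    rw [pd_mul (hφS.mul hφS) hfS i hy, pd_mul hφS hφS i hy]; ring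
  have hF2 : ∀ i, pd i (pd i (fun y => (φ y * φ y) * f y)) z
      = 8 * (z i * z i) * f z - 4 * φ z * f z - 8 * φ z * z i * pd i f z
        + φ z * φ z * pd i (pd i f) z := by
    intro i
    have s1 := hφS.mul (hφS.pd i)
    rw [pd_congr hU i (hF1 i) hzU,
      pd_add (((Sm.const 2).mul s1).mul hfS) ((hφS.mul hφS).mul (hfS.pd i)) i hzU,
      pd_mul ((Sm.const 2).mul s1) hfS i hzU, pd_mul (Sm.const 2) s1 i hzU, pd_const,
      pd_mul hφS (hφS.pd i) i hzU, pd_mul (hφS.mul hφS) (hfS.pd i) i hzU,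
      pd_mul hφS hφS i hzU, hφ2, hφ1 i z hzU]
    ring
  have hg1 : ∀ i, φ z * pd i f z = 4 * z i * f z := by
    intro i
    have := (pd_pd_nonpos hU hF hzU hloc i).1
    rw [hF1 i z hzU, hφ1 i z hzU] at this
    have h0 : φ z * (φ z * pd i f z - 4 * z i * f z) = 0 := by linarith
    rcases mul_eq_zero.mp h0 with h | h
    · exact absurd h hφz.ne'
    · linarith
  have hsum : ∑ i, (8 * (z i * z i) * f z - 4 * φ z * f z - 8 * φ z * z i * pd i f z
        + φ z * φ z * pd i (pd i f) z) ≤ 0 := by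
    apply Finset.sum_nonpos
    intro i _
    rw [← hF2 i]
    exact (pd_pd_nonpos hU hF hzU hloc i).2
  have hsum2 : -24 * ‖z‖ ^ 2 * f z - 4 * n * φ z * f z
      + φ z * φ z * ∑ i, pd i (pd i f) z ≤ 0 := by
    refine le_trans (le_of_eq ?_) hsum
    rw [norm_sq_sum, Finset.sum_add_distrib, ← Finset.mul_sum]
    congr 1
    have : ∀ i, 8 * (z i * z i) * f z - 4 * φ z * f z - 8 * φ z * z i * pd i f z
        = (-24 * f z) * (z i * z i) - 4 * φ z * f z := by
      intro i
      have := hg1 i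
      linear_combination (-8 * z i) * this
    simp only [this, Finset.sum_sub_distrib, ← Finset.mul_sum]
    simp
    ring
  have hBz := hB z hzU
  change 1 / (2 * (n:ℝ)) * (f z) ^ 2 - _ ≤ _ at hBz
  have hin : φ z * ∑ j, pd j w z * pd j f z = 4 * f z * ∑ j, pd j w z * z j := by
    rw [Finset.mul_sum, Finset.mul_sum]
    refine Finset.sum_congr rfl fun j _ => ?_
    linear_combination (pd j w z) * hg1 j
  set T := ∑ j, pd j w z * z j with hT
  set c := 1 / (2 * (n:ℝ)) with hc
  have hc0 : 0 < c := by positivity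
  have hcn : c * n = 1 / 2 := by rw [hc]; field_simp
  have h6 : c * (φ z * φ z) * f z ≤ 24 * ‖z‖ ^ 2 + 4 * n * φ z + 8 * φ z * T := by
    have := mul_le_mul_of_nonneg_left hBz (mul_nonneg hφz0 hφz0)
    have h7 : f z * (c * (φ z * φ z) * f z) ≤
        f z * (24 * ‖z‖ ^ 2 + 4 * n * φ z + 8 * φ z * T) := by
      have e : φ z * φ z * (2 * ∑ j, pd j w z * pd j f z) = 8 * φ z * f z * T := by
        linear_combination (2 * φ z) * hin
      linarith
    exact le_of_mul_le_mul_left h7 hfz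
  have h8 : 8 * φ z * T ≤ c / 2 * (φ z * φ z) * f z + 64 * n * ‖z‖ ^ 2 := by
    rw [hT, norm_sq_sum, hf]
    simp only [Finset.mul_sum]
    rw [← Finset.sum_add_distrib]
    refine Finset.sum_le_sum fun j _ => ?_
    have hsq := mul_nonneg hn0.le (sq_nonneg (c * (φ z * pd j w z) - 8 * z j))
    have hexp : (n:ℝ) * (c * (φ z * pd j w z) - 8 * z j) ^ 2
      = (c * n) * (c * (φ z * pd j w z) ^ 2) - 16 * (c * n) * (φ z * pd j w z) * z j
        + 64 * n * (z j * z j) := by ring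
    rw [hexp, hcn] at hsq
    linarith
  have h9 : c / 2 * (φ z * φ z) * f z ≤ (24 + 68 * n) * r ^ 2 := by
    have : ‖z‖ ^ 2 ≤ r ^ 2 := by gcongr
    have h10 : φ z ≤ r ^ 2 := by simp only [hφ]; linarith [sq_nonneg ‖z‖]
    have h11 := mul_le_mul_of_nonneg_left this hn0.le
    have h12 := mul_le_mul_of_nonneg_left h10 hn0.le
    linarith
  have h13 := mul_le_mul_of_nonneg_left h9 (by positivity : (0:ℝ) ≤ 4 * n)
  have h14 : 4 * n * (c / 2 * (φ z * φ z) * f z) = (φ z * φ z) * f z := by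
    linear_combination (2 * (φ z * φ z) * f z) * hcn
  linarith

lemma norm_gradient_sq {n : ℕ} (v : EuclideanSpace ℝ (Fin n) → ℝ)
    (x : EuclideanSpace ℝ (Fin n)) : ‖gradient v x‖ ^ 2 = ∑ i, pd i v x * pd i v x := by
  rw [norm_sq_sum]
  refine Finset.sum_congr rfl fun i _ => ?_
  have : gradient v x i = pd i v x := by
    have h : inner ℝ (gradient v x) (EuclideanSpace.single i (1:ℝ)) = pd i v x := by
      unfold gradient pd
      exact InnerProductSpace.toDual_symm_apply
    rw [← h, EuclideanSpace.inner_single_right]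
    simp
  rw [this]

theorem stmt_5 (n : ℕ) (hn : 3 ≤ n) :
    ∃ C : ℝ, 0 < C ∧
      ∀ μ a b : ℝ, 0 ≤ μ → a ≤ 0 → 0 ≤ b →
        ∀ R : ℝ, 0 < R →
          ∀ v : EuclideanSpace ℝ (Fin n) → ℝ, ContDiff ℝ (⊤ : ℕ∞) v →
            (∀ x ∈ Metric.ball (0 : EuclideanSpace ℝ (Fin n)) R, 0 < v x) →
            (∀ x ∈ Metric.ball (0 : EuclideanSpace ℝ (Fin n)) R,
              lap v x + μ * v x + a * v x ^ (((n : ℝ) + 2) / ((n : ℝ) - 2))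
                + b * v x ^ (-(3 * (n : ℝ) - 2) / ((n : ℝ) - 2)) = 0) →
            ∀ x ∈ Metric.ball (0 : EuclideanSpace ℝ (Fin n)) (R / 2),
              ‖gradient v x‖ ^ 2 / (v x) ^ 2 ≤ C / R ^ 2 := by
  have hn3 : (3:ℝ) ≤ n := by exact_mod_cast hn
  refine ⟨6 * (4 * n * (24 + 68 * n)), by positivity, ?_⟩
  intro μ a b hμ ha hb R hR v hv hpos heq x hx
  set U := Metric.ball (0 : EuclideanSpace ℝ (Fin n)) R with hUdef
  have hU : IsOpen U := Metric.isOpen_ball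
  have hvS : Sm U v := fun y _ => hv.contDiffAt
  set w : EuclideanSpace ℝ (Fin n) → ℝ := fun y => log (v y) with hw
  have hwS : Sm U w := fun y hy => (hvS y hy).log (hpos y hy).ne'
  have hvi : Sm U (fun y => (v y)⁻¹) := fun y hy => (hvS y hy).inv (hpos y hy).ne'
  have hw1 : ∀ i, ∀ y ∈ U, pd i w y = (v y)⁻¹ * pd i v y := fun i y hy =>
    pd_comp hvS i hy (hasDerivAt_log (hpos y hy).ne')
  have hw2 : ∀ i, ∀ y ∈ U, pd i (pd i w) y
      = (v y)⁻¹ * pd i (pd i v) y - pd i w y * pd i w y := by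
    intro i y hy
    rw [pd_congr hU i (hw1 i) hy, pd_mul hvi (hvS.pd i) i hy,
      pd_comp hvS i hy (hasDerivAt_inv (hpos y hy).ne'), hw1 i y hy]
    have := (hpos y hy).ne'
    field_simp
    ring
  have hn2 : (0:ℝ) < n - 2 := by linarith
  have hrp : ∀ s t : ℝ, s = t + 1 → ∀ y ∈ U, (v y)⁻¹ * v y ^ s = exp (t * w y) := by
    intro s t hst y hy
    rw [hst, rpow_add_one (hpos y hy).ne', rpow_def_of_pos (hpos y hy), mul_comm t]
    have := (hpos y hy).ne'
    field_simp
    rw [hw, mul_comm]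
  have hE : ∀ y ∈ U, ∑ i, pd i (pd i w) y =
      -(∑ j, pd j w y * pd j w y) + (-μ + (-a * exp (4 / ((n:ℝ) - 2) * w y)
        + -b * exp (-(4 * ((n:ℝ) - 1) / ((n:ℝ) - 2)) * w y))) := by
    intro y hy
    rw [Finset.sum_congr rfl (fun i _ => hw2 i y hy), Finset.sum_sub_distrib, ← Finset.mul_sum]
    have h1 := heq y hy
    have h2 : lap v y = ∑ i, pd i (pd i v) y := rfl
    rw [← h2]
    rw [← hrp _ _ (show ((n : ℝ) + 2) / ((n : ℝ) - 2) = 4 / ((n:ℝ) - 2) + 1 by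
        field_simp; ring) y hy,
      ← hrp _ _ (show -(3 * (n : ℝ) - 2) / ((n : ℝ) - 2)
        = -(4 * ((n:ℝ) - 1) / ((n:ℝ) - 2)) + 1 by field_simp; ring) y hy]
    have h3 : (v y)⁻¹ * v y = 1 := inv_mul_cancel₀ (hpos y hy).ne'
    linear_combination (v y)⁻¹ * h1 - μ * h3
  have hB := fun y (hy : y ∈ U) => bochner hn hU hwS hμ ha hb
    (p := 4 / ((n:ℝ) - 2)) (q := 4 * ((n:ℝ) - 1) / ((n:ℝ) - 2))
    (by rw [div_le_div_iff₀ (by positivity) hn2]; linarith)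
    (div_nonneg (by linarith) hn2.le) hE hy
  have hx2 : ‖x‖ < R / 2 := by simpa using hx
  have hxU : x ∈ U := by simp only [hUdef, mem_ball_zero_iff]; linarith
  have hM := maxstep hn (r := 3 * R / 4) (by linarith) (by linarith) hwS hB
    (x := x) (by linarith)
  have hgoal : ‖gradient v x‖ ^ 2 / (v x) ^ 2 = ∑ j, pd j w x * pd j w x := by
    rw [norm_gradient_sq, Finset.sum_div]
    refine Finset.sum_congr rfl fun i _ => ?_
    rw [hw1 i x hxU]
    have := (hpos x hxU).ne'
    field_simp
  rw [hgoal]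
  set f := ∑ j, pd j w x * pd j w x with hf
  have hf0 : 0 ≤ f := Finset.sum_nonneg fun k _ => mul_self_nonneg _
  set K : ℝ := 4 * n * (24 + 68 * n) with hK
  have hK0 : 0 ≤ K := by positivity
  rw [le_div_iff₀ (by positivity)]
  have hxs : ‖x‖ ^ 2 ≤ (R / 2) ^ 2 := by gcongr
  have h1 : (5 / 16 * R ^ 2) ^ 2 * f ≤ K * (3 * R / 4) ^ 2 := by
    refine le_trans ?_ hM
    gcongr
    nlinarith
  have h2 : R ^ 2 * (f * R ^ 2) ≤ R ^ 2 * (6 * K) := by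
    have : 0 ≤ K * R ^ 2 := by positivity
    nlinarith
  exact le_of_mul_le_mul_left h2 (by positivity)
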